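/- Let C, D, E be k-coalgebras, M a (C,D)-bicomodule with coactions λ_M : M → C ⊗ M and ρ_M : M → M ⊗ D, and N a (D,E)-bicomodule with coactions λ_N : N → D ⊗ N and ρ_N : N → N ⊗ E. Since every k-module is flat, C ⊗ (M □_D N) and (M □_D N) ⊗ E are submodules of C ⊗ M ⊗ N and M ⊗ N ⊗ E respectively. Then (λ_M ⊗ id_N)(M □_D N) ⊆ C ⊗ (M □_D N) and (id_M ⊗ ρ_N)(M □_D N) ⊆ (M □_D N) ⊗ E, and the corestricted maps make M □_D N a (C,E)-bicomodule: the induced left coaction is coassociative and counital, the induced right coaction is coassociative and counital, and the two induced coactions commute. -/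

import Mathlib

open TensorProduct LinearMap

noncomputable section

structure RightCoaction (k C M : Type*) [CommRing k]
    [AddCommGroup C] [Module k C] [Coalgebra k C]
    [AddCommGroup M] [Module k M] where
  ρ : M →ₗ[k] M ⊗[k] C
  coassoc : TensorProduct.assoc k M C C ∘ₗ ρ.rTensor C ∘ₗ ρ
      = LinearMap.lTensor M (Coalgebra.comul (R := k) (A := C)) ∘ₗ ρ
  counit : LinearMap.lTensor M (Coalgebra.counit (R := k) (A := C)) ∘ₗ ρ
      = (TensorProduct.rid k M).symm.toLinearMap

structure LeftCoaction (k C M : Type*) [CommRing k]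
    [AddCommGroup C] [Module k C] [Coalgebra k C]
    [AddCommGroup M] [Module k M] where
  lam : M →ₗ[k] C ⊗[k] M
  coassoc : TensorProduct.assoc k C C M ∘ₗ
        LinearMap.rTensor M (Coalgebra.comul (R := k) (A := C)) ∘ₗ lam
      = LinearMap.lTensor C lam ∘ₗ lam
  counit : LinearMap.rTensor M (Coalgebra.counit (R := k) (A := C)) ∘ₗ lam
      = (TensorProduct.lid k M).symm.toLinearMap

structure Bicomodule (k C D M : Type*) [CommRing k]
    [AddCommGroup C] [Module k C] [Coalgebra k C]
    [AddCommGroup D] [Module k D] [Coalgebra k D]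
    [AddCommGroup M] [Module k M] where
  left : LeftCoaction k C M
  right : RightCoaction k D M
  compat : TensorProduct.assoc k C M D ∘ₗ LinearMap.rTensor D left.lam ∘ₗ right.ρ
      = LinearMap.lTensor C right.ρ ∘ₗ left.lam

variable {k C D E M N : Type*} [CommRing k] [IsSemisimpleRing k]
  [AddCommGroup C] [Module k C] [Coalgebra k C]
  [AddCommGroup D] [Module k D] [Coalgebra k D]
  [AddCommGroup E] [Module k E] [Coalgebra k E]
  [AddCommGroup M] [Module k M]
  [AddCommGroup N] [Module k N]

/-- The cotensor product `M □_D N`, the kernel of `ρ_M ⊗ id_N − id_M ⊗ λ_N` in `M ⊗ N`. -/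
def cotensor (ρM : RightCoaction k D M) (lamN : LeftCoaction k D N) :
    Submodule k (M ⊗[k] N) :=
  LinearMap.ker
    ((TensorProduct.assoc k M D N).toLinearMap ∘ₗ LinearMap.rTensor N ρM.ρ
      - LinearMap.lTensor M lamN.lam)

/-- `λ_M ⊗ id_N`, valued in `C ⊗ (M ⊗ N)`. -/
def Lmap (lamM : LeftCoaction k C M) : M ⊗[k] N →ₗ[k] C ⊗[k] (M ⊗[k] N) :=
  (TensorProduct.assoc k C M N).toLinearMap ∘ₗ LinearMap.rTensor N lamM.lam

/-- `id_M ⊗ ρ_N`, valued in `(M ⊗ N) ⊗ E`. -/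
def Rmap (ρN : RightCoaction k E N) : M ⊗[k] N →ₗ[k] (M ⊗[k] N) ⊗[k] E :=
  (TensorProduct.assoc k M N E).symm.toLinearMap ∘ₗ LinearMap.lTensor M ρN.ρ

/-- `M ⊗ N` is a left `C`-comodule whenever `M` is. -/
def LeftCoaction.tensor (L : LeftCoaction k C M) : LeftCoaction k C (M ⊗[k] N) where
  lam := Lmap L
  coassoc := by
    refine TensorProduct.ext' fun m n => ?_
    have h := congrArg
      (fun t => ((TensorProduct.assoc k C M N).toLinearMap.lTensor C ∘ₗ
        (TensorProduct.assoc k C (C ⊗[k] M) N).toLinearMap) (t ⊗ₜ[k] n))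
      (LinearMap.congr_fun L.coassoc m)
    simp only [LinearMap.comp_apply, Lmap, LinearMap.rTensor_tmul, LinearEquiv.coe_coe] at h ⊢
    generalize L.lam m = t at h ⊢
    convert h using 1
    · clear h
      induction t with
      | zero => simp
      | add x y hx hy => simp only [map_add, add_tmul, hx, hy]
      | tmul c m =>
        simp only [assoc_tmul, rTensor_tmul]
        generalize Coalgebra.comul (R := k) c = s
        induction s with
        | zero => simp
        | add x y hx hy => simp only [map_add, add_tmul, hx, hy]
        | tmul c d => simp
    · clear h
      induction t with
      | zero => simp
      | add x y hx hy => simp only [map_add, add_tmul, hx, hy]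
      | tmul c m => simp
  counit := by
    refine TensorProduct.ext' fun m n => ?_
    have h := congrArg (fun t => TensorProduct.assoc k k M N (t ⊗ₜ[k] n))
      (LinearMap.congr_fun L.counit m)
    simp only [LinearMap.comp_apply, Lmap, LinearMap.rTensor_tmul, LinearEquiv.coe_coe,
      lid_symm_apply, assoc_tmul] at h ⊢
    rw [← h]
    generalize L.lam m = t
    induction t with
    | zero => simp
    | add x y hx hy => simp only [map_add, add_tmul, hx, hy]
    | tmul c m => simp

/-- `M ⊗ N` is a right `E`-comodule whenever `N` is. -/
def RightCoaction.tensor (R : RightCoaction k E N) : RightCoaction k E (M ⊗[k] N) where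
  ρ := Rmap R
  coassoc := by
    refine TensorProduct.ext' fun m n => ?_
    have h := congrArg
      (fun t => (TensorProduct.assoc k M N (E ⊗[k] E)).symm (m ⊗ₜ[k] t))
      (LinearMap.congr_fun R.coassoc n)
    simp only [LinearMap.comp_apply, Rmap, LinearMap.lTensor_tmul, LinearEquiv.coe_coe] at h ⊢
    generalize R.ρ n = t at h ⊢
    convert h using 1
    · clear h
      induction t with
      | zero => simp
      | add x y hx hy => simp only [map_add, tmul_add, hx, hy]
      | tmul n e =>
        simp only [assoc_symm_tmul, rTensor_tmul, LinearMap.comp_apply, LinearMap.lTensor_tmul,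
          LinearEquiv.coe_coe]
        generalize R.ρ n = s
        induction s with
        | zero => simp
        | add x y hx hy => simp only [map_add, tmul_add, add_tmul, hx, hy]
        | tmul c d => simp
    · clear h
      induction t with
      | zero => simp
      | add x y hx hy => simp only [map_add, tmul_add, hx, hy]
      | tmul n e => simp
  counit := by
    refine TensorProduct.ext' fun m n => ?_
    have h := congrArg (fun t => (TensorProduct.assoc k M N k).symm (m ⊗ₜ[k] t))
      (LinearMap.congr_fun R.counit n)
    simp only [LinearMap.comp_apply, Rmap, LinearMap.lTensor_tmul, LinearEquiv.coe_coe,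
      rid_symm_apply, assoc_symm_tmul] at h ⊢
    rw [← h]
    generalize R.ρ n = t
    induction t with
    | zero => simp
    | add x y hx hy => simp only [map_add, tmul_add, hx, hy]
    | tmul n e => simp

/-- `M ⊗ N` is a `(C,E)`-bicomodule for a left `C`-comodule `M` and a right `E`-comodule `N`. -/
def Bicomodule.tensor (L : LeftCoaction k C M) (R : RightCoaction k E N) :
    Bicomodule k C E (M ⊗[k] N) where
  left := L.tensor
  right := R.tensor
  compat := by
    refine TensorProduct.ext' fun m n => ?_
    simp only [LeftCoaction.tensor, RightCoaction.tensor, LinearMap.comp_apply, Lmap, Rmap,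
      LinearMap.rTensor_tmul, LinearMap.lTensor_tmul, LinearEquiv.coe_coe]
    trans (TensorProduct.assoc k M N E).symm.toLinearMap.lTensor C
      (TensorProduct.assoc k C M (N ⊗[k] E) (L.lam m ⊗ₜ[k] R.ρ n))
    · generalize R.ρ n = t
      induction t with
      | zero => simp
      | add x y hx hy => simp only [map_add, tmul_add, hx, hy]
      | tmul n e =>
        simp only [assoc_symm_tmul, LinearMap.rTensor_tmul, LinearMap.comp_apply,
          LinearEquiv.coe_coe]
        generalize L.lam m = s
        induction s with
        | zero => simp
        | add x y hx hy => simp only [map_add, add_tmul, hx, hy]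
        | tmul c d => simp
    · generalize L.lam m = s
      induction s with
      | zero => simp
      | add x y hx hy => simp only [map_add, add_tmul, hx, hy]
      | tmul c d => simp

/-- Over a semisimple ring every module is flat. -/
theorem flat_of_isSemisimpleRing (P : Type*) [AddCommGroup P] [Module k P] : Module.Flat k P :=
  have := Module.projective_of_isSemisimpleRing k P
  inferInstance

/-- A coaction corestricts to a subcomodule. -/
theorem LeftCoaction.exists_restrict (L : LeftCoaction k C M) (V : Submodule k M)
    (hV : ∀ x ∈ V, L.lam x ∈ LinearMap.range (V.subtype.lTensor C)) :
    ∃ L' : LeftCoaction k C V, V.subtype.lTensor C ∘ₗ L'.lam = L.lam ∘ₗ V.subtype := by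
  have := flat_of_isSemisimpleRing (k := k) C
  have hi : Function.Injective (V.subtype.lTensor C) :=
    Module.Flat.lTensor_preserves_injective_linearMap _ V.injective_subtype
  let l : V →ₗ[k] C ⊗[k] V :=
    LinearMap.codRestrictOfInjective (L.lam ∘ₗ V.subtype) (V.subtype.lTensor C) hi
      fun x => hV x x.2
  have hl : V.subtype.lTensor C ∘ₗ l = L.lam ∘ₗ V.subtype :=
    LinearMap.codRestrictOfInjective_comp _ _ hi _
  have hl' (x : V) : V.subtype.lTensor C (l x) = L.lam x := LinearMap.congr_fun hl x
  refine ⟨⟨l, ?_, ?_⟩, hl⟩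
  · have hii : Function.Injective ((V.subtype.lTensor C).lTensor C) :=
      Module.Flat.lTensor_preserves_injective_linearMap _ hi
    refine LinearMap.ext fun x => hii ?_
    have h := LinearMap.congr_fun L.coassoc x
    simp only [LinearMap.comp_apply, LinearEquiv.coe_coe, ← hl'] at h ⊢
    rw [← LinearMap.lTensor_comp_apply C (V.subtype.lTensor C), hl, LinearMap.lTensor_comp_apply,
      ← h]
    generalize l x = t
    induction t with
    | zero => simp
    | add x y hx hy => simp only [map_add, hx, hy]
    | tmul c m =>
      simp only [LinearMap.rTensor_tmul, LinearMap.lTensor_tmul]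
      generalize Coalgebra.comul (R := k) c = s
      induction s with
      | zero => simp
      | add x y hx hy => simp only [map_add, add_tmul, hx, hy]
      | tmul c d => simp
  · have hk : Function.Injective (V.subtype.lTensor k) :=
      Module.Flat.lTensor_preserves_injective_linearMap _ V.injective_subtype
    refine LinearMap.ext fun x => hk ?_
    have h := LinearMap.congr_fun L.counit x
    simp only [LinearMap.comp_apply, LinearEquiv.coe_coe, ← hl', lid_symm_apply,
      LinearMap.lTensor_tmul, Submodule.subtype_apply] at h ⊢
    rw [← h]
    exact LinearMap.congr_fun ((LinearMap.lTensor_comp_rTensor ..).trans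
      (LinearMap.rTensor_comp_lTensor ..).symm) (l x)

/-- A coaction corestricts to a subcomodule. -/
theorem RightCoaction.exists_restrict (R : RightCoaction k C M) (V : Submodule k M)
    (hV : ∀ x ∈ V, R.ρ x ∈ LinearMap.range (V.subtype.rTensor C)) :
    ∃ R' : RightCoaction k C V, V.subtype.rTensor C ∘ₗ R'.ρ = R.ρ ∘ₗ V.subtype := by
  have := flat_of_isSemisimpleRing (k := k) C
  have hi : Function.Injective (V.subtype.rTensor C) :=
    Module.Flat.rTensor_preserves_injective_linearMap _ V.injective_subtype
  let r : V →ₗ[k] V ⊗[k] C :=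
    LinearMap.codRestrictOfInjective (R.ρ ∘ₗ V.subtype) (V.subtype.rTensor C) hi
      fun x => hV x x.2
  have hr : V.subtype.rTensor C ∘ₗ r = R.ρ ∘ₗ V.subtype :=
    LinearMap.codRestrictOfInjective_comp _ _ hi _
  have hr' (x : V) : V.subtype.rTensor C (r x) = R.ρ x := LinearMap.congr_fun hr x
  refine ⟨⟨r, ?_, ?_⟩, hr⟩
  · have hii : Function.Injective (V.subtype.rTensor (C ⊗[k] C)) :=
      Module.Flat.rTensor_preserves_injective_linearMap _ V.injective_subtype
    refine LinearMap.ext fun x => hii ?_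
    have h := LinearMap.congr_fun R.coassoc x
    simp only [LinearMap.comp_apply, LinearEquiv.coe_coe, ← hr'] at h ⊢
    have hnat (t : (V ⊗[k] C) ⊗[k] C) :
        V.subtype.rTensor (C ⊗[k] C) (TensorProduct.assoc k V C C t) =
          TensorProduct.assoc k M C C ((V.subtype.rTensor C).rTensor C t) := by
      rw [LinearMap.rTensor_tensor]
      simp
    rw [hnat, ← LinearMap.rTensor_comp_apply C (V.subtype.rTensor C), hr,
      LinearMap.rTensor_comp_apply, h]
    exact LinearMap.congr_fun ((LinearMap.lTensor_comp_rTensor ..).trans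
      (LinearMap.rTensor_comp_lTensor ..).symm) (r x)
  · have hk : Function.Injective (V.subtype.rTensor k) :=
      Module.Flat.rTensor_preserves_injective_linearMap _ V.injective_subtype
    refine LinearMap.ext fun x => hk ?_
    have h := LinearMap.congr_fun R.counit x
    simp only [LinearMap.comp_apply, LinearEquiv.coe_coe, ← hr', rid_symm_apply,
      LinearMap.rTensor_tmul, Submodule.subtype_apply] at h ⊢
    rw [← h]
    exact LinearMap.congr_fun ((LinearMap.rTensor_comp_lTensor ..).trans
      (LinearMap.lTensor_comp_rTensor ..).symm) (r x)

/-- A bicomodule structure corestricts to a submodule stable under both coactions. -/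
theorem Bicomodule.exists_restrict (B : Bicomodule k C E M) (V : Submodule k M)
    (hL : ∀ x ∈ V, B.left.lam x ∈ LinearMap.range (V.subtype.lTensor C))
    (hR : ∀ x ∈ V, B.right.ρ x ∈ LinearMap.range (V.subtype.rTensor E)) :
    ∃ B' : Bicomodule k C E V,
      V.subtype.lTensor C ∘ₗ B'.left.lam = B.left.lam ∘ₗ V.subtype ∧
        V.subtype.rTensor E ∘ₗ B'.right.ρ = B.right.ρ ∘ₗ V.subtype := by
  obtain ⟨L, hl⟩ := B.left.exists_restrict V hL
  obtain ⟨R, hr⟩ := B.right.exists_restrict V hR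
  refine ⟨⟨L, R, ?_⟩, hl, hr⟩
  have := flat_of_isSemisimpleRing (k := k) C
  have := flat_of_isSemisimpleRing (k := k) E
  have hi : Function.Injective ((V.subtype.rTensor E).lTensor C) :=
    Module.Flat.lTensor_preserves_injective_linearMap _
      (Module.Flat.rTensor_preserves_injective_linearMap _ V.injective_subtype)
  refine LinearMap.ext fun x => hi ?_
  have h := LinearMap.congr_fun B.compat x
  have hl' : V.subtype.lTensor C (L.lam x) = B.left.lam x := LinearMap.congr_fun hl x
  have hr' : V.subtype.rTensor E (R.ρ x) = B.right.ρ x := LinearMap.congr_fun hr x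
  simp only [LinearMap.comp_apply, LinearEquiv.coe_coe, ← hl', ← hr'] at h ⊢
  have hnat (t : (C ⊗[k] V) ⊗[k] E) :
      (V.subtype.rTensor E).lTensor C (TensorProduct.assoc k C V E t) =
        TensorProduct.assoc k C M E ((V.subtype.lTensor C).rTensor E t) :=
    LinearMap.congr_fun (TensorProduct.map_map_comp_assoc_eq .id V.subtype .id) t
  rw [hnat, ← LinearMap.rTensor_comp_apply E (V.subtype.lTensor C), hl,
    LinearMap.rTensor_comp_apply, h, ← LinearMap.lTensor_comp_apply C (V.subtype.rTensor E), hr,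
    LinearMap.lTensor_comp_apply]

/-- `λ_M ⊗ id_N` maps `M □_D N` into `C ⊗ (M □_D N)`. -/
theorem Lmap_mem_range (BM : Bicomodule k C D M) (lamN : LeftCoaction k D N)
    {x : M ⊗[k] N} (hx : x ∈ cotensor BM.right lamN) :
    Lmap (N := N) BM.left x ∈
      LinearMap.range ((cotensor BM.right lamN).subtype.lTensor C) := by
  have := flat_of_isSemisimpleRing (k := k) C
  refine (Module.Flat.lTensor_exact C (LinearMap.exact_subtype_ker_map _) _).1 ?_
  have hρ : ((TensorProduct.assoc k M D N).toLinearMap ∘ₗ BM.right.ρ.rTensor N).lTensor C ∘ₗ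
        Lmap BM.left =
      Lmap (N := D ⊗[k] N) BM.left ∘ₗ
        (TensorProduct.assoc k M D N).toLinearMap ∘ₗ BM.right.ρ.rTensor N := by
    refine TensorProduct.ext' fun m n => ?_
    have h := congrArg
      (fun t => ((TensorProduct.assoc k M D N).toLinearMap.lTensor C ∘ₗ
        (TensorProduct.assoc k C (M ⊗[k] D) N).toLinearMap) (t ⊗ₜ[k] n))
      (LinearMap.congr_fun BM.compat m)
    simp only [LinearMap.comp_apply, Lmap, LinearMap.rTensor_tmul, LinearEquiv.coe_coe] at h ⊢
    convert h.symm using 1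
    · generalize BM.left.lam m = t
      induction t with
      | zero => simp
      | add x y hx hy => simp only [map_add, add_tmul, hx, hy]
      | tmul c m => simp
    · generalize BM.right.ρ m = t
      induction t with
      | zero => simp
      | add x y hx hy => simp only [map_add, add_tmul, hx, hy]
      | tmul m d =>
        simp only [assoc_tmul, LinearMap.rTensor_tmul]
        generalize BM.left.lam m = s
        induction s with
        | zero => simp
        | add x y hx hy => simp only [map_add, add_tmul, hx, hy]
        | tmul c d => simp
  have hlam : (lamN.lam.lTensor M).lTensor C ∘ₗ Lmap BM.left =
      Lmap (N := D ⊗[k] N) BM.left ∘ₗ lamN.lam.lTensor M := by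
    refine TensorProduct.ext' fun m n => ?_
    simp only [LinearMap.comp_apply, Lmap, LinearMap.rTensor_tmul, LinearMap.lTensor_tmul,
      LinearEquiv.coe_coe]
    generalize BM.left.lam m = t
    induction t with
    | zero => simp
    | add x y hx hy => simp only [map_add, add_tmul, hx, hy]
    | tmul c m => simp
  rw [← LinearMap.comp_apply, LinearMap.lTensor_sub, LinearMap.sub_comp, hρ, hlam,
    ← LinearMap.comp_sub, LinearMap.comp_apply, LinearMap.mem_ker.1 hx, map_zero]

/-- `id_M ⊗ ρ_N` maps `M □_D N` into `(M □_D N) ⊗ E`. -/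
theorem Rmap_mem_range (ρM : RightCoaction k D M) (BN : Bicomodule k D E N)
    {x : M ⊗[k] N} (hx : x ∈ cotensor ρM BN.left) :
    Rmap (M := M) BN.right x ∈
      LinearMap.range ((cotensor ρM BN.left).subtype.rTensor E) := by
  have := flat_of_isSemisimpleRing (k := k) E
  refine (Module.Flat.rTensor_exact E (LinearMap.exact_subtype_ker_map _) _).1 ?_
  have hρ : ((TensorProduct.assoc k M D N).toLinearMap ∘ₗ ρM.ρ.rTensor N).rTensor E ∘ₗ
        Rmap BN.right =
      Rmap (M := M) (BN.right.tensor (M := D)) ∘ₗ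
        (TensorProduct.assoc k M D N).toLinearMap ∘ₗ ρM.ρ.rTensor N := by
    refine TensorProduct.ext' fun m n => ?_
    simp only [LinearMap.comp_apply, Rmap, RightCoaction.tensor, LinearMap.rTensor_tmul,
      LinearMap.lTensor_tmul, LinearEquiv.coe_coe]
    trans (TensorProduct.assoc k M D N).toLinearMap.rTensor E
      ((TensorProduct.assoc k (M ⊗[k] D) N E).symm (ρM.ρ m ⊗ₜ[k] BN.right.ρ n))
    · generalize BN.right.ρ n = t
      induction t with
      | zero => simp
      | add x y hx hy => simp only [map_add, tmul_add, hx, hy]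
      | tmul n e => simp
    · generalize ρM.ρ m = s
      induction s with
      | zero => simp
      | add x y hx hy => simp only [map_add, add_tmul, hx, hy]
      | tmul m d =>
        simp only [assoc_tmul, LinearMap.lTensor_tmul, LinearMap.comp_apply, LinearEquiv.coe_coe]
        generalize BN.right.ρ n = t
        induction t with
        | zero => simp
        | add x y hx hy => simp only [map_add, tmul_add, hx, hy]
        | tmul n e => simp
  have hlam : (BN.left.lam.lTensor M).rTensor E ∘ₗ Rmap BN.right =
      Rmap (M := M) (BN.right.tensor (M := D)) ∘ₗ BN.left.lam.lTensor M := by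
    refine TensorProduct.ext' fun m n => ?_
    have h := congrArg
      (fun t => (TensorProduct.assoc k M (D ⊗[k] N) E).symm
        (m ⊗ₜ[k] (TensorProduct.assoc k D N E).symm t))
      (LinearMap.congr_fun BN.compat n)
    simp only [LinearMap.comp_apply, Rmap, RightCoaction.tensor, LinearMap.lTensor_tmul,
      LinearEquiv.coe_coe, LinearEquiv.symm_apply_apply] at h ⊢
    rw [← h]
    generalize BN.right.ρ n = t
    induction t with
    | zero => simp
    | add x y hx hy => simp only [map_add, tmul_add, hx, hy]
    | tmul n e => simp
  rw [← LinearMap.comp_apply, LinearMap.rTensor_sub, LinearMap.sub_comp, hρ, hlam,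
    ← LinearMap.comp_sub, LinearMap.comp_apply, LinearMap.mem_ker.1 hx, map_zero]

/-- `M □_D N` is a `(C,E)`-bicomodule: `λ_M ⊗ id_N` and `id_M ⊗ ρ_N` corestrict to
`C ⊗ (M □_D N)` and `(M □_D N) ⊗ E` (viewed as submodules of `C ⊗ M ⊗ N` and `M ⊗ N ⊗ E`
via flatness), and the corestricted coactions are coassociative, counital and commute. -/
theorem cotensor_bicomodule (BM : Bicomodule k C D M) (BN : Bicomodule k D E N) :
    (∀ x ∈ cotensor BM.right BN.left,
        Lmap (N := N) BM.left x ∈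
          LinearMap.range
            (LinearMap.lTensor C (cotensor BM.right BN.left).subtype)) ∧
    (∀ x ∈ cotensor BM.right BN.left,
        Rmap (M := M) BN.right x ∈
          LinearMap.range
            (LinearMap.rTensor E (cotensor BM.right BN.left).subtype)) ∧
    ∃ B : Bicomodule k C E ↥(cotensor BM.right BN.left),
      LinearMap.lTensor C (cotensor BM.right BN.left).subtype ∘ₗ B.left.lam
          = Lmap (N := N) BM.left ∘ₗ (cotensor BM.right BN.left).subtype ∧
        LinearMap.rTensor E (cotensor BM.right BN.left).subtype ∘ₗ B.right.ρ
          = Rmap (M := M) BN.right ∘ₗ (cotensor BM.right BN.left).subtype := by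
  have hL := fun x hx => Lmap_mem_range (x := x) BM BN.left hx
  have hR := fun x hx => Rmap_mem_range (x := x) BM.right BN hx
  exact ⟨hL, hR, (Bicomodule.tensor BM.left BN.right).exists_restrict _ hL hR⟩

end
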